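/- Fix α, β ∈ (0, ∞). Let X_n be the number of nonempty boxes on the second main diagonal of a random α/β-staircase tableau of size n. Then for every integer r ≥ 1, the r-th factorial moment satisfies E_{n,α,β}[X_n(X_n−1)⋯(X_n−r+1)] → 1 as n → ∞. -/

import Mathlib

open scoped BigOperators

/-- A symbol in an α/β-staircase tableau: empty, α, or β. -/
inductive StairSymb : Type
  | empty : StairSymb
  | alpha : StairSymb
  | beta  : StairSymb
  deriving DecidableEq

/-- `S` is an α/β-staircase tableau of size `n` (1-based indexing; boxes are the
pairs `(i,j)` with `1 ≤ i`, `1 ≤ j`, `i + j ≤ n + 1`; outside the boxes `S` is empty). -/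
def IsStaircase (n : ℕ) (S : ℕ → ℕ → StairSymb) : Prop :=
  (∀ i j, ¬(1 ≤ i ∧ 1 ≤ j ∧ i + j ≤ n + 1) → S i j = StairSymb.empty) ∧
  (∀ i i' j, 1 ≤ i → i < i' → 1 ≤ j → i' + j ≤ n + 1 →
    S i' j = StairSymb.alpha → S i j = StairSymb.empty) ∧
  (∀ i j j', 1 ≤ i → 1 ≤ j → j < j' → i + j' ≤ n + 1 →
    S i j' = StairSymb.beta → S i j = StairSymb.empty) ∧
  (∀ i j, 1 ≤ i → 1 ≤ j → i + j = n + 1 → S i j ≠ StairSymb.empty)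

/-- The weight `wt(S) = α^{N_α(S)} β^{N_β(S)}` of a tableau. -/
noncomputable def stairWt (α β : ℝ) (S : ℕ → ℕ → StairSymb) : ℝ :=
  α ^ Set.ncard {p : ℕ × ℕ | S p.1 p.2 = StairSymb.alpha} *
  β ^ Set.ncard {p : ℕ × ℕ | S p.1 p.2 = StairSymb.beta}

/-- The partition function `Z_n(α,β)`, the total weight of all tableaux of size `n`. -/
noncomputable def stairZ (n : ℕ) (α β : ℝ) : ℝ :=
  ∑ᶠ S ∈ {S : ℕ → ℕ → StairSymb | IsStaircase n S}, stairWt α β S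

/-- The probability `ℙ_{n,α,β}(E)` of an event `E` (a set of tableaux of size `n`). -/
noncomputable def stairP (n : ℕ) (α β : ℝ) (E : (ℕ → ℕ → StairSymb) → Prop) : ℝ :=
  (∑ᶠ S ∈ {S : ℕ → ℕ → StairSymb | IsStaircase n S ∧ E S}, stairWt α β S) / stairZ n α β

/-- The expectation `E_{n,α,β}[f]` of a real function of the random tableau. -/
noncomputable def stairE (n : ℕ) (α β : ℝ) (f : (ℕ → ℕ → StairSymb) → ℝ) : ℝ :=
  (∑ᶠ S ∈ {S : ℕ → ℕ → StairSymb | IsStaircase n S}, f S * stairWt α β S) / stairZ n α β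

section TableauMoments

open StairSymb
open scoped Finset

/-- The `α`-rule within a column whose nonempty boxes lie in the rows `R`. -/
def stairColumns (R : Finset ℕ) : Set (ℕ → StairSymb) :=
  {c | (∀ i ∉ R, c i = empty) ∧ ∀ i i', i < i' → c i' = alpha → c i = empty}

/-- The weight of a column. -/
noncomputable def columnWt (α β : ℝ) (c : ℕ → StairSymb) : ℝ :=
  α ^ Set.ncard {i | c i = alpha} * β ^ Set.ncard {i | c i = beta}

instance : Finite StairSymb :=
  Set.finite_univ_iff.1 <| (Set.toFinite {empty, alpha, beta}).subset fun s _ => by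
    cases s <;> simp

theorem stairColumns_finite (R : Finset ℕ) : (stairColumns R).Finite := by
  refine Set.Finite.of_injOn (f := fun c (i : R) => c i) (t := Set.univ)
    (fun _ _ => Set.mem_univ _) ?_ Set.finite_univ
  intro c hc d hd h
  funext i
  by_cases hi : i ∈ R
  · exact congrFun h ⟨i, hi⟩
  · rw [hc.1 i hi, hd.1 i hi]

theorem finite_symb_set {R : Finset ℕ} {c : ℕ → StairSymb} (hc : ∀ i ∉ R, c i = empty)
    {s : StairSymb} (hs : s ≠ empty) : {i | c i = s}.Finite :=
  R.finite_toSet.subset fun i hi => by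
    by_contra h
    exact hs (hi.symm.trans (hc i h))

theorem columnWt_update_beta (α β : ℝ) {R : Finset ℕ} {c : ℕ → StairSymb} {a : ℕ}
    (hc : ∀ i ∉ R, c i = empty) (ha : a ∉ R) :
    columnWt α β (Function.update c a beta) = β * columnWt α β c := by
  have hca := hc a ha
  have h1 : {i | Function.update c a beta i = alpha} = {i | c i = alpha} := by
    ext i
    by_cases h : i = a <;> simp_all [Function.update]
  have h2 : {i | Function.update c a beta i = beta} = insert a {i | c i = beta} := by
    ext i
    by_cases h : i = a <;> simp_all [Function.update]
  rw [columnWt, h1, h2, Set.ncard_insert_of_notMem (by simp [hca])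
    (finite_symb_set hc (by simp)), columnWt]
  ring

theorem columnWt_single_alpha (α β : ℝ) (a : ℕ) :
    columnWt α β (Function.update (fun _ => empty) a alpha) = α := by
  have h1 : {i | Function.update (fun _ => empty) a alpha i = alpha} = {a} := by
    ext i
    by_cases h : i = a <;> simp_all [Function.update]
  have h2 : {i | Function.update (fun _ => empty) a alpha i = beta} = ∅ := by
    ext i
    by_cases h : i = a <;> simp_all [Function.update]
  rw [columnWt, h1, h2]
  simp

/-- The weighted count of columns, where every row of `R` not containing `β` contributes `x`. -/
noncomputable def columnSum (α β x : ℝ) (R : Finset ℕ) : ℝ :=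
  ∑ᶠ c ∈ stairColumns R, columnWt α β c * x ^ #{i ∈ R | c i ≠ beta}

theorem columnSum_empty (α β x : ℝ) : columnSum α β x ∅ = 1 := by
  have : stairColumns ∅ = {fun _ => empty} := by
    ext c
    simp only [stairColumns, Set.mem_ofPred_eq, Set.mem_singleton_iff, funext_iff]
    constructor
    · intro h i
      exact h.1 i (by simp)
    · intro h
      exact ⟨fun i _ => h i, fun i _ _ _ => h i⟩
  rw [columnSum, this, finsum_mem_singleton]
  simp [columnWt]

theorem stairColumns_insert_nonempty {R : Finset ℕ} {a : ℕ} (ha : ∀ i ∈ R, i < a) :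
    {c | c ∈ stairColumns (insert a R) ∧ c a ≠ empty} =
      (fun c => Function.update c a beta) '' stairColumns R ∪
        {Function.update (fun _ => empty) a alpha} := by
  ext c
  simp only [Set.mem_ofPred_eq, Set.mem_union, Set.mem_image, Set.mem_singleton_iff]
  constructor
  · rintro ⟨⟨h1, h2⟩, h3⟩
    rcases h : c a with _ | _ | _
    · exact absurd h h3
    · right
      funext i
      by_cases hi : i = a
      · simp [hi, h]
      · rw [Function.update_of_ne hi]
        by_cases hR : i ∈ R
        · exact h2 i a (ha i hR) h
        · exact h1 i (by simp [hi, hR])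
    · left
      refine ⟨Function.update c a empty, ⟨?_, ?_⟩, ?_⟩
      · intro i hi
        by_cases hia : i = a
        · simp [hia]
        · rw [Function.update_of_ne hia]
          exact h1 i (by simp [hi, hia])
      · intro i i' hii h4
        by_cases hia : i = a
        · simp [hia]
        · rw [Function.update_of_ne hia]
          refine h2 i i' hii ?_
          by_cases hia' : i' = a
          · simp [hia'] at h4
          · rwa [Function.update_of_ne hia'] at h4
      · simp [← h]
  · rintro (⟨d, ⟨h1, h2⟩, rfl⟩ | rfl)
    · refine ⟨⟨?_, ?_⟩, by simp⟩
      · intro i hi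
        rw [Finset.mem_insert, not_or] at hi
        rw [Function.update_of_ne hi.1]
        exact h1 i hi.2
      · intro i i' hii h4
        have hia' : i' ≠ a := by
          rintro rfl
          simp at h4
        rw [Function.update_of_ne hia'] at h4
        have : i' ∈ R := by
          by_contra h
          simp [h1 i' h] at h4
        rw [Function.update_of_ne (by have := ha i' this; omega)]
        exact h2 i i' hii h4
    · refine ⟨⟨?_, ?_⟩, by simp⟩
      · intro i hi
        rw [Finset.mem_insert, not_or] at hi
        rw [Function.update_of_ne hi.1]
      · intro i i' hii h4
        have hia' : i' = a := by
          by_contra h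
          simp [Function.update_of_ne h] at h4
        rw [Function.update_of_ne (by omega)]

theorem columnSum_nonempty_eq (α β x : ℝ) {R : Finset ℕ} {a : ℕ} (ha : ∀ i ∈ R, i < a) :
    ∑ᶠ c ∈ {c | c ∈ stairColumns (insert a R) ∧ c a ≠ empty},
        columnWt α β c * x ^ #{i ∈ insert a R | c i ≠ beta} =
      β * columnSum α β x R + α * x ^ (#R + 1) := by
  have haR : a ∉ R := fun h => (ha a h).false
  have hinj : Set.InjOn (fun c => Function.update c a beta) (stairColumns R) := by
    intro c hc d hd h
    funext i
    by_cases hi : i = a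
    · rw [hi, hc.1 a haR, hd.1 a haR]
    · simpa [Function.update_of_ne hi] using congrFun h i
  have hdisj : Disjoint ((fun c => Function.update c a beta) '' stairColumns R)
      {Function.update (fun _ => empty) a alpha} := by
    rw [Set.disjoint_singleton_right]
    rintro ⟨c, _, hc⟩
    simpa using congrFun hc a
  rw [stairColumns_insert_nonempty ha,
    finsum_mem_union hdisj ((stairColumns_finite R).image _) (Set.finite_singleton _),
    finsum_mem_singleton, finsum_mem_image hinj, columnWt_single_alpha, columnSum,
    mul_finsum_mem]
  congr 1
  · refine finsum_mem_congr rfl fun c hc => ?_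
    rw [columnWt_update_beta α β hc.1 haR, Finset.filter_insert]
    have : {i ∈ R | Function.update c a beta i ≠ beta} = {i ∈ R | c i ≠ beta} :=
      Finset.filter_congr fun i hi => by
        rw [Function.update_of_ne (ha i hi).ne]
    simp only [Function.update_self, ne_eq, not_true_eq_false, if_false] at this ⊢
    rw [this]
    ring
  · have : {i ∈ insert a R | Function.update (fun _ => empty) a alpha i ≠ beta}
        = insert a R :=
      Finset.filter_true_of_mem fun i _ => by
        by_cases h : i = a <;> simp [Function.update, h]
    rw [this, Finset.card_insert_of_notMem haR]

theorem columnSum_insert (α β x : ℝ) {R : Finset ℕ} {a : ℕ} (ha : ∀ i ∈ R, i < a) :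
    columnSum α β x (insert a R) =
      x * columnSum α β x R + (β * columnSum α β x R + α * x ^ (#R + 1)) := by
  have haR : a ∉ R := fun h => (ha a h).false
  have hempty : {c | c ∈ stairColumns (insert a R) ∧ c a = empty} = stairColumns R := by
    ext c
    simp only [stairColumns, Set.mem_ofPred_eq, Finset.mem_insert]
    constructor
    · rintro ⟨⟨h1, h2⟩, h3⟩
      refine ⟨fun i hi => ?_, h2⟩
      by_cases h : i = a
      · rw [h, h3]
      · exact h1 i (by simp [h, hi])
    · rintro ⟨h1, h2⟩
      exact ⟨⟨fun i hi => h1 i fun h => hi (Or.inr h), h2⟩, h1 a haR⟩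
  have hsplit : stairColumns (insert a R) =
      {c | c ∈ stairColumns (insert a R) ∧ c a = empty} ∪
        {c | c ∈ stairColumns (insert a R) ∧ c a ≠ empty} := by
    ext c
    simp only [Set.mem_union, Set.mem_ofPred_eq]
    tauto
  have hfin := stairColumns_finite (insert a R)
  have hdisj : Disjoint {c | c ∈ stairColumns (insert a R) ∧ c a = empty}
      {c | c ∈ stairColumns (insert a R) ∧ c a ≠ empty} :=
    Set.disjoint_left.2 fun c h h' => h'.2 h.2
  rw [columnSum, hsplit,
    finsum_mem_union hdisj (hfin.subset fun c h => h.1) (hfin.subset fun c h => h.1),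
    columnSum_nonempty_eq α β x ha, hempty, columnSum, mul_finsum_mem _ x]
  refine congrArg (· + _) (finsum_mem_congr rfl fun c hc => ?_)
  have : {i ∈ insert a R | c i ≠ beta} = insert a {i ∈ R | c i ≠ beta} := by
    rw [Finset.filter_insert, if_pos (by simp [hc.1 a haR])]
  rw [this, Finset.card_insert_of_notMem (by simp [haR])]
  ring

theorem columnSum_closed_form (α β x : ℝ) (R : Finset ℕ) :
    β * columnSum α β x R + α * x ^ (#R + 1) = (β + α * x) * (x + β) ^ #R := by
  induction R using Finset.induction_on_max with
  | empty => simp [columnSum_empty]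
  | insert a R ha ih =>
    rw [columnSum_insert α β x ha, Finset.card_insert_of_notMem fun h => (ha a h).false]
    linear_combination (x + β) * ih

theorem columnSum_nonempty (α β x : ℝ) {R : Finset ℕ} {a : ℕ} (ha : ∀ i ∈ R, i < a) :
    ∑ᶠ c ∈ {c | c ∈ stairColumns (insert a R) ∧ c a ≠ empty},
        columnWt α β c * x ^ #{i ∈ insert a R | c i ≠ beta} =
      (β + α * x) * (x + β) ^ #R := by
  rw [columnSum_nonempty_eq α β x ha, columnSum_closed_form]

open scoped Classical in
/-- The rows of a tableau of size `n` which contain no `β`. -/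
noncomputable def freeRows (n : ℕ) (S : ℕ → ℕ → StairSymb) : Finset ℕ :=
  {i ∈ Finset.Icc 1 n | ∀ j, S i j ≠ beta}

theorem mem_freeRows {n : ℕ} {S : ℕ → ℕ → StairSymb} {i : ℕ} :
    i ∈ freeRows n S ↔ (1 ≤ i ∧ i ≤ n) ∧ ∀ j, S i j ≠ beta := by
  simp [freeRows]

theorem lt_of_mem_freeRows {n : ℕ} {S : ℕ → ℕ → StairSymb} :
    ∀ i ∈ freeRows n S, i < n + 1 := fun i hi => by
  have := (mem_freeRows.1 hi).1
  omega

/-- Insertion of a new first column. -/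
def consColumn (S : ℕ → ℕ → StairSymb) (c : ℕ → StairSymb) : ℕ → ℕ → StairSymb
  | _, 0 => empty
  | i, 1 => c i
  | i, j + 2 => S i (j + 1)

/-- Deletion of the first column. -/
def tailColumns (S : ℕ → ℕ → StairSymb) : ℕ → ℕ → StairSymb
  | _, 0 => empty
  | i, j + 1 => S i (j + 2)

/-- The admissible first columns in front of the tableau `S` of size `n`. -/
def firstColumns (n : ℕ) (S : ℕ → ℕ → StairSymb) : Set (ℕ → StairSymb) :=
  {c | c ∈ stairColumns (insert (n + 1) (freeRows n S)) ∧ c (n + 1) ≠ empty}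

theorem firstColumns_finite (n : ℕ) (S : ℕ → ℕ → StairSymb) : (firstColumns n S).Finite :=
  (stairColumns_finite _).subset fun _ h => h.1

theorem IsStaircase.eq_empty_of_zero_right {n : ℕ} {S : ℕ → ℕ → StairSymb} (hS : IsStaircase n S)
    (i : ℕ) : S i 0 = empty := hS.1 _ _ (by omega)

theorem IsStaircase.consColumn {n : ℕ} {S : ℕ → ℕ → StairSymb} {c : ℕ → StairSymb}
    (hS : IsStaircase n S) (hc : c ∈ firstColumns n S) :
    IsStaircase (n + 1) (consColumn S c) := by
  obtain ⟨h1, h2, h3, h4⟩ := hS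
  obtain ⟨⟨hc1, hc2⟩, hc3⟩ := hc
  refine ⟨?_, ?_, ?_, ?_⟩
  · rintro i (_ | _ | j) h
    · rfl
    · refine hc1 i fun hi => h ?_
      rcases Finset.mem_insert.1 hi with rfl | hi
      · omega
      · have := (mem_freeRows.1 hi).1
        omega
    · exact h1 _ _ (by omega)
  · rintro i i' (_ | _ | j) hi hii hj hb h
    · rfl
    · exact hc2 i i' hii h
    · exact h2 i i' (j + 1) hi hii (by omega) (by omega) h
  · rintro i (_ | _ | j) (_ | _ | j') hi hj hjj hb h <;> try omega
    · refine hc1 i fun hi' => ?_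
      rcases Finset.mem_insert.1 hi' with rfl | hi'
      · omega
      · exact (mem_freeRows.1 hi').2 _ h
    · exact h3 i (j + 1) (j' + 1) hi (by omega) (by omega) (by omega) h
  · rintro i (_ | _ | j) hi hj hb
    · omega
    · have : i = n + 1 := by omega
      exact this ▸ hc3
    · exact h4 i (j + 1) hi (by omega) (by omega)

theorem IsStaircase.tailColumns {n : ℕ} {S : ℕ → ℕ → StairSymb} (hS : IsStaircase (n + 1) S) :
    IsStaircase n (tailColumns S) := by
  obtain ⟨h1, h2, h3, h4⟩ := hS
  refine ⟨?_, ?_, ?_, ?_⟩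
  · rintro i (_ | j) h
    · rfl
    · exact h1 _ _ (by omega)
  · rintro i i' (_ | j) hi hii hj hb h
    · rfl
    · exact h2 i i' _ hi hii (by omega) (by omega) h
  · rintro i (_ | j) (_ | j') hi hj hjj hb h <;> try omega
    exact h3 i _ (j' + 2) hi (by omega) (by omega) (by omega) h
  · rintro i (_ | j) hi hj hb
    · omega
    · exact h4 i _ hi (by omega) (by omega)

theorem IsStaircase.firstColumn_mem {n : ℕ} {S : ℕ → ℕ → StairSymb}
    (hS : IsStaircase (n + 1) S) :
    (fun i => S i 1) ∈ firstColumns n (_root_.tailColumns S) := by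
  obtain ⟨h1, h2, h3, h4⟩ := hS
  refine ⟨⟨?_, ?_⟩, h4 _ _ (by omega) le_rfl (by omega)⟩
  · intro i hi
    rw [Finset.mem_insert, mem_freeRows] at hi
    by_cases hb : 1 ≤ i ∧ i ≤ n
    · have : ∃ j, _root_.tailColumns S i j = beta := by
        by_contra! h
        exact hi (Or.inr ⟨hb, h⟩)
      obtain ⟨_ | j, hj⟩ := this
      · cases hj
      · have hj' : S i (j + 2) = beta := hj
        refine h3 i 1 (j + 2) hb.1 le_rfl (by omega) ?_ hj'
        by_contra hlt
        rw [h1 i (j + 2) (by omega)] at hj'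
        cases hj'
    · exact h1 _ _ (by omega)
  · intro i i' hii h
    by_cases hi : 1 ≤ i
    · refine h2 i i' 1 hi hii le_rfl ?_ h
      by_contra hlt
      have := h1 i' 1 (by omega)
      simp_all
    · exact h1 _ _ (by omega)

theorem consColumn_tailColumns {n : ℕ} {S : ℕ → ℕ → StairSymb} (hS : IsStaircase n S) :
    consColumn (tailColumns S) (fun i => S i 1) = S := by
  funext i j
  rcases j with _ | _ | j
  · exact (hS.eq_empty_of_zero_right i).symm
  · rfl
  · rfl

theorem tailColumns_consColumn {n : ℕ} {S : ℕ → ℕ → StairSymb} (hS : IsStaircase n S)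
    (c : ℕ → StairSymb) : tailColumns (consColumn S c) = S := by
  funext i j
  rcases j with _ | j
  · exact (hS.eq_empty_of_zero_right i).symm
  · rfl

theorem setOf_isStaircase_succ (n : ℕ) :
    {S | IsStaircase (n + 1) S} =
      ⋃ S ∈ {S | IsStaircase n S}, consColumn S '' firstColumns n S := by
  ext S
  simp only [Set.mem_ofPred_eq, Set.mem_iUnion, Set.mem_image, exists_prop]
  constructor
  · intro hS
    exact ⟨_, hS.tailColumns, _, hS.firstColumn_mem, consColumn_tailColumns hS⟩
  · rintro ⟨S, hS, c, hc, rfl⟩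
    exact hS.consColumn hc

theorem setOf_isStaircase_zero : {S | IsStaircase 0 S} = {fun _ _ => empty} := by
  ext S
  simp only [Set.mem_ofPred_eq, Set.mem_singleton_iff]
  constructor
  · intro h
    funext i j
    exact h.1 i j (by omega)
  · rintro rfl
    exact ⟨fun _ _ _ => rfl, fun _ _ _ _ _ _ _ _ => rfl, fun _ _ _ _ _ _ _ _ => rfl,
      fun i j _ _ _ => by omega⟩

theorem setOf_isStaircase_finite (n : ℕ) : {S | IsStaircase n S}.Finite := by
  induction n with
  | zero =>
    rw [setOf_isStaircase_zero]
    exact Set.finite_singleton _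
  | succ n ih =>
    rw [setOf_isStaircase_succ]
    exact ih.biUnion fun S _ => (firstColumns_finite n S).image _

theorem IsStaircase.finite_setOf_eq {n : ℕ} {S : ℕ → ℕ → StairSymb} (hS : IsStaircase n S)
    {s : StairSymb} (hs : s ≠ empty) : {p : ℕ × ℕ | S p.1 p.2 = s}.Finite := by
  refine ((Set.finite_Iic (n + 1)).prod (Set.finite_Iic (n + 1))).subset fun p hp => ?_
  by_contra h
  refine hs (Eq.trans (Eq.symm hp) (hS.1 _ _ fun hb => h ?_))
  simp only [Set.mem_prod, Set.mem_Iic]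
  omega

theorem ncard_consColumn {n : ℕ} {S : ℕ → ℕ → StairSymb} {c : ℕ → StairSymb}
    (hS : IsStaircase n S) (hc : c ∈ firstColumns n S) {s : StairSymb} (hs : s ≠ empty) :
    {p : ℕ × ℕ | consColumn S c p.1 p.2 = s}.ncard =
      {i | c i = s}.ncard + {p : ℕ × ℕ | S p.1 p.2 = s}.ncard := by
  have hunion : {p : ℕ × ℕ | consColumn S c p.1 p.2 = s} =
      (fun i => (i, 1)) '' {i | c i = s} ∪
        (fun p => (p.1, p.2 + 1)) '' {p : ℕ × ℕ | S p.1 p.2 = s} := by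
    ext ⟨i, j⟩
    simp only [Set.mem_union, Set.mem_image, Set.mem_ofPred_eq, Prod.mk.injEq, Prod.exists]
    constructor
    · rcases j with _ | _ | j
      · exact fun h => absurd h.symm hs
      · exact fun h => Or.inl ⟨i, h, rfl, rfl⟩
      · exact fun h => Or.inr ⟨i, j + 1, h, rfl, rfl⟩
    · rintro (⟨_, h, rfl, rfl⟩ | ⟨_, _ | k, h, rfl, rfl⟩)
      · exact h
      · exact absurd (h.symm.trans (hS.eq_empty_of_zero_right _)) hs
      · exact h
  have hdisj : Disjoint ((fun i => (i, 1)) '' {i | c i = s})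
      ((fun p => (p.1, p.2 + 1)) '' {p : ℕ × ℕ | S p.1 p.2 = s}) := by
    rw [Set.disjoint_left]
    rintro _ ⟨i, _, rfl⟩ ⟨⟨i', k⟩, h, h'⟩
    simp only [Prod.mk.injEq] at h'
    obtain rfl : k = 0 := by omega
    exact hs (Eq.trans (Eq.symm h) (hS.eq_empty_of_zero_right _))
  rw [hunion, Set.ncard_union_eq hdisj ((finite_symb_set hc.1.1 hs).image _)
    ((hS.finite_setOf_eq hs).image _), Set.ncard_image_of_injective _ fun i j h => by simpa using h,
    Set.ncard_image_of_injective _ fun p q h => by simpa [Prod.ext_iff] using h]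

theorem stairWt_consColumn (α β : ℝ) {n : ℕ} {S : ℕ → ℕ → StairSymb} {c : ℕ → StairSymb}
    (hS : IsStaircase n S) (hc : c ∈ firstColumns n S) :
    stairWt α β (consColumn S c) = columnWt α β c * stairWt α β S := by
  rw [stairWt, ncard_consColumn hS hc (by simp), ncard_consColumn hS hc (by simp), stairWt,
    columnWt]
  ring

theorem freeRows_consColumn {n : ℕ} {S : ℕ → ℕ → StairSymb}
    (hS : IsStaircase n S) (c : ℕ → StairSymb) :
    freeRows (n + 1) (consColumn S c) = {i ∈ insert (n + 1) (freeRows n S) | c i ≠ beta} := by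
  have hrow (i : ℕ) : (∀ j, consColumn S c i j ≠ beta) ↔ c i ≠ beta ∧ ∀ j, S i j ≠ beta := by
    constructor
    · refine fun h => ⟨h 1, ?_⟩
      rintro (_ | j)
      · simp [hS.eq_empty_of_zero_right]
      · exact h (j + 2)
    · rintro ⟨h, h'⟩ (_ | _ | j)
      · simp [consColumn]
      · exact h
      · exact h' (j + 1)
  have hlast : ∀ j, S (n + 1) j ≠ beta := fun j => by
    rw [hS.1 _ _ (by omega)]
    simp
  ext i
  rw [mem_freeRows, hrow, Finset.mem_filter, Finset.mem_insert, mem_freeRows]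
  constructor
  · rintro ⟨hi, h, h'⟩
    refine ⟨?_, h⟩
    by_cases hin : i = n + 1
    · exact Or.inl hin
    · exact Or.inr ⟨by omega, h'⟩
  · rintro ⟨rfl | ⟨hi, h'⟩, h⟩
    · exact ⟨by omega, h, hlast⟩
    · exact ⟨by omega, h, h'⟩

/-- The partition function in which each row without `β` carries an extra factor `x`. -/
noncomputable def rowGenFun (n : ℕ) (α β x : ℝ) : ℝ :=
  ∑ᶠ S ∈ {S | IsStaircase n S}, stairWt α β S * x ^ #(freeRows n S)

theorem rowGenFun_succ (n : ℕ) (α β x : ℝ) :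
    rowGenFun (n + 1) α β x = (β + α * x) * rowGenFun n α β (x + β) := by
  have hdisj : {S | IsStaircase n S}.PairwiseDisjoint
      fun S => consColumn S '' firstColumns n S := by
    intro S hS T hT hST
    rw [Function.onFun, Set.disjoint_left]
    rintro _ ⟨c, _, rfl⟩ ⟨d, _, h⟩
    refine hST ?_
    rw [← tailColumns_consColumn hS c, ← h, tailColumns_consColumn hT d]
  rw [rowGenFun, setOf_isStaircase_succ, finsum_mem_biUnion hdisj (setOf_isStaircase_finite n)
    fun S _ => (firstColumns_finite n S).image _, rowGenFun, mul_finsum_mem]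
  refine finsum_mem_congr rfl fun S hS => ?_
  rw [finsum_mem_image fun _ _ _ _ h => funext fun i => congrFun (congrFun h i) 1]
  trans ∑ᶠ c ∈ firstColumns n S, stairWt α β S *
    (columnWt α β c * x ^ #{i ∈ insert (n + 1) (freeRows n S) | c i ≠ beta})
  · refine finsum_mem_congr rfl fun c hc => ?_
    rw [stairWt_consColumn α β hS hc, freeRows_consColumn hS c]
    ring
  · rw [← mul_finsum_mem, firstColumns, columnSum_nonempty α β x lt_of_mem_freeRows]
    ring

theorem rowGenFun_eq_prod (n : ℕ) (α β x : ℝ) :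
    rowGenFun n α β x = ∏ i ∈ Finset.range n, (β + α * (x + i * β)) := by
  induction n generalizing x with
  | zero =>
    rw [rowGenFun, setOf_isStaircase_zero, finsum_mem_singleton]
    simp [stairWt, freeRows]
  | succ n ih =>
    rw [rowGenFun_succ, ih, Finset.prod_range_succ', mul_comm]
    congr 1
    · refine Finset.prod_congr rfl fun i _ => ?_
      push_cast
      ring
    · simp

theorem stairZ_eq_prod (n : ℕ) (α β : ℝ) :
    stairZ n α β = ∏ i ∈ Finset.range n, (α + β + i * (α * β)) := by
  have h := rowGenFun_eq_prod n α β 1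
  simp only [rowGenFun, one_pow, mul_one] at h
  rw [stairZ, h]
  exact Finset.prod_congr rfl fun i _ => by ring

/-- The order embedding of `ℕ` with range the complement of `{a}`. -/
def skipIndex (a i : ℕ) : ℕ := if i < a then i else i + 1

/-- The left inverse of `skipIndex a`. -/
def unskipIndex (a i : ℕ) : ℕ := if i < a then i else i - 1

/-- Insertion of a new row `p + 1` with the only symbol `β` in column `j`, and a new column
`j + 1` with the only symbol `α` in row `p`. -/
def insertCorner (p j : ℕ) (S : ℕ → ℕ → StairSymb) : ℕ → ℕ → StairSymb := fun i k =>
  if i = p + 1 then (if k = j then beta else empty)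
  else if k = j + 1 then (if i = p then alpha else empty)
  else S (unskipIndex (p + 1) i) (unskipIndex (j + 1) k)

/-- Deletion of row `p + 1` and column `j + 1`. -/
def deleteCorner (p j : ℕ) (S : ℕ → ℕ → StairSymb) : ℕ → ℕ → StairSymb := fun i k =>
  S (skipIndex (p + 1) i) (skipIndex (j + 1) k)

theorem skipIndex_ne (a i : ℕ) : skipIndex a i ≠ a := by
  unfold skipIndex; split_ifs <;> omega

theorem unskipIndex_skipIndex (a i : ℕ) : unskipIndex a (skipIndex a i) = i := by
  unfold skipIndex unskipIndex; split_ifs <;> omega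

theorem skipIndex_unskipIndex {a i : ℕ} (h : i ≠ a) : skipIndex a (unskipIndex a i) = i := by
  unfold skipIndex unskipIndex; split_ifs <;> omega

theorem deleteCorner_insertCorner (p j : ℕ) (S : ℕ → ℕ → StairSymb) :
    deleteCorner p j (insertCorner p j S) = S := by
  funext i k
  simp [deleteCorner, insertCorner, skipIndex_ne, unskipIndex_skipIndex]

section SecondDiagonal

variable {n p j : ℕ} {S : ℕ → ℕ → StairSymb}

theorem IsStaircase.below_eq_beta (hS : IsStaircase n S) (hp : 1 ≤ p) (hj : 1 ≤ j)
    (hpj : p + j = n) (h : S p j ≠ empty) : S (p + 1) j = beta := by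
  rcases hs : S (p + 1) j with _ | _ | _
  · exact absurd hs (hS.2.2.2 _ _ (by omega) hj (by omega))
  · exact absurd (hS.2.1 p (p + 1) j hp (by omega) hj (by omega) hs) h
  · rfl

theorem IsStaircase.right_eq_alpha (hS : IsStaircase n S) (hp : 1 ≤ p) (hj : 1 ≤ j)
    (hpj : p + j = n) (h : S p j ≠ empty) : S p (j + 1) = alpha := by
  rcases hs : S p (j + 1) with _ | _ | _
  · exact absurd hs (hS.2.2.2 _ _ hp (by omega) (by omega))
  · rfl
  · exact absurd (hS.2.2.1 p j (j + 1) hp hj (by omega) (by omega) hs) h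

theorem IsStaircase.insertCorner_deleteCorner (hS : IsStaircase n S) (hp : 1 ≤ p) (hj : 1 ≤ j)
    (hpj : p + j = n) (h : S p j ≠ empty) : insertCorner p j (deleteCorner p j S) = S := by
  have hb := hS.below_eq_beta hp hj hpj h
  have ha := hS.right_eq_alpha hp hj hpj h
  obtain ⟨h1, h2, h3, h4⟩ := hS
  funext i k
  unfold insertCorner deleteCorner
  split_ifs with hi hk hk hi'
  · rw [hi, hk, hb]
  · rw [hi]
    by_cases hkb : 1 ≤ k ∧ k < j
    · exact (h3 (p + 1) k j (by omega) hkb.1 hkb.2 (by omega) hb).symm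
    · exact (h1 _ _ (by omega)).symm
  · rw [hi', hk, ha]
  · rw [hk]
    by_cases hib : 1 ≤ i ∧ i < p
    · exact (h2 i p (j + 1) hib.1 hib.2 (by omega) (by omega) ha).symm
    · exact (h1 _ _ (by omega)).symm
  · rw [skipIndex_unskipIndex hi, skipIndex_unskipIndex hk]

theorem IsStaircase.deleteCorner (hS : IsStaircase (n + 1) S) (hp : 1 ≤ p) (hj : 1 ≤ j)
    (hpj : p + j = n + 1) (h : S p j ≠ empty) : IsStaircase n (deleteCorner p j S) := by
  obtain ⟨h1, h2, h3, h4⟩ := hS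
  refine ⟨?_, ?_, ?_, ?_⟩
  · intro i k hik
    refine h1 _ _ ?_
    unfold skipIndex
    split_ifs <;> omega
  · intro i i' k hi hii hk hb hs
    refine h2 _ _ _ ?_ ?_ ?_ ?_ hs <;> unfold skipIndex <;> split_ifs <;> omega
  · intro i k k' hi hk hkk hb hs
    refine h3 _ _ _ ?_ ?_ ?_ ?_ hs <;> unfold skipIndex <;> split_ifs <;> omega
  · intro i k hi hk hb
    by_cases hip : i = p
    · obtain rfl : k = j := by omega
      simpa [_root_.deleteCorner, skipIndex, hip] using h
    · refine h4 _ _ ?_ ?_ ?_ <;> unfold skipIndex <;> split_ifs <;> omega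

theorem IsStaircase.insertCorner (hS : IsStaircase n S) (hp : 1 ≤ p) (hj : 1 ≤ j)
    (hpj : p + j = n + 1) : IsStaircase (n + 1) (insertCorner p j S) := by
  obtain ⟨h1, h2, h3, h4⟩ := hS
  refine ⟨?_, ?_, ?_, ?_⟩
  · intro i k hik
    unfold _root_.insertCorner
    split_ifs <;> first | omega | rfl | skip
    refine h1 _ _ ?_
    unfold unskipIndex
    split_ifs <;> omega
  · intro i i' k hi hii hk hb hs
    unfold _root_.insertCorner at hs ⊢
    split_ifs at hs ⊢ <;> first | omega | rfl | skip
    refine h2 _ _ _ ?_ ?_ ?_ ?_ hs <;> unfold unskipIndex <;> split_ifs <;> omega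
  · intro i k k' hi hk hkk hb hs
    unfold _root_.insertCorner at hs ⊢
    split_ifs at hs ⊢ <;> first | omega | rfl | skip
    refine h3 _ _ _ ?_ ?_ ?_ ?_ hs <;> unfold unskipIndex <;> split_ifs <;> omega
  · intro i k hi hk hb
    unfold _root_.insertCorner
    split_ifs <;> first | omega | simp
    refine h4 _ _ ?_ ?_ ?_ <;> unfold unskipIndex <;> split_ifs <;> omega

theorem insertCorner_self (p j : ℕ) (S : ℕ → ℕ → StairSymb) : insertCorner p j S p j = S p j := by
  simp [insertCorner, unskipIndex]

theorem setOf_isStaircase_nonempty (hp : 1 ≤ p) (hj : 1 ≤ j) (hpj : p + j = n + 1) :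
    {S | IsStaircase (n + 1) S ∧ S p j ≠ empty} = insertCorner p j '' {S | IsStaircase n S} := by
  ext S
  simp only [Set.mem_ofPred_eq, Set.mem_image]
  constructor
  · rintro ⟨hS, h⟩
    exact ⟨_, hS.deleteCorner hp hj hpj h, hS.insertCorner_deleteCorner hp hj hpj h⟩
  · rintro ⟨S, hS, rfl⟩
    refine ⟨hS.insertCorner hp hj hpj, ?_⟩
    rw [insertCorner_self]
    exact hS.2.2.2 _ _ hp hj hpj

theorem ncard_insertCorner (hS : IsStaircase n S) {s : StairSymb} (hs : s ≠ empty) {q : ℕ × ℕ}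
    (hq : (q = (p + 1, j) ∧ s = beta) ∨ (q = (p, j + 1) ∧ s = alpha)) :
    {r : ℕ × ℕ | insertCorner p j S r.1 r.2 = s}.ncard =
      {r : ℕ × ℕ | S r.1 r.2 = s}.ncard + 1 := by
  have hinsert : {r : ℕ × ℕ | insertCorner p j S r.1 r.2 = s} = insert q
      ((fun r => (skipIndex (p + 1) r.1, skipIndex (j + 1) r.2)) ''
        {r : ℕ × ℕ | S r.1 r.2 = s}) := by
    ext ⟨i, k⟩
    simp only [Set.mem_insert_iff, Set.mem_image, Set.mem_ofPred_eq, Prod.mk.injEq, Prod.exists]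
    constructor
    · intro h
      unfold insertCorner at h
      split_ifs at h with hi hk hk hi' <;> try exact absurd h.symm hs
      · rcases hq with ⟨rfl, _⟩ | ⟨rfl, rfl⟩
        · simp [hi, hk]
        · cases h
      · rcases hq with ⟨rfl, rfl⟩ | ⟨rfl, _⟩
        · cases h
        · simp [hi', hk]
      · exact Or.inr ⟨_, _, h, skipIndex_unskipIndex hi, skipIndex_unskipIndex hk⟩
    · rintro (h | ⟨i, k, h, rfl, rfl⟩)
      · rcases hq with ⟨rfl, rfl⟩ | ⟨rfl, rfl⟩ <;> simp_all [insertCorner]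
      · simp [insertCorner, skipIndex_ne, unskipIndex_skipIndex, h]
  have hq' : q ∉ (fun r => (skipIndex (p + 1) r.1, skipIndex (j + 1) r.2)) ''
        {r : ℕ × ℕ | S r.1 r.2 = s} := by
    rintro ⟨r, _, rfl⟩
    rcases hq with ⟨h, _⟩ | ⟨h, _⟩
    · exact skipIndex_ne _ _ (congrArg Prod.fst h)
    · exact skipIndex_ne _ _ (congrArg Prod.snd h)
  rw [hinsert, Set.ncard_insert_of_notMem hq' ((hS.finite_setOf_eq hs).image _),
    Set.ncard_image_of_injective]
  intro r r' h
  have h1 := congrArg (unskipIndex (p + 1) ·.1) h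
  have h2 := congrArg (unskipIndex (j + 1) ·.2) h
  simp only [unskipIndex_skipIndex] at h1 h2
  exact Prod.ext h1 h2

theorem stairWt_insertCorner (α β : ℝ) (hS : IsStaircase n S) (p j : ℕ) :
    stairWt α β (insertCorner p j S) = α * β * stairWt α β S := by
  rw [stairWt, ncard_insertCorner hS (by simp) (Or.inr ⟨rfl, rfl⟩),
    ncard_insertCorner hS (by simp) (Or.inl ⟨rfl, rfl⟩), stairWt]
  ring

/-- The number of nonempty boxes in the first `m` columns of the second main diagonal. -/
def secondDiagCount (n m : ℕ) (S : ℕ → ℕ → StairSymb) : ℕ :=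
  #{i ∈ Finset.Icc 1 m | S (n - i) i ≠ empty}

theorem secondDiagCount_zero (n : ℕ) (S : ℕ → ℕ → StairSymb) : secondDiagCount n 0 S = 0 := by
  simp [secondDiagCount]

theorem secondDiagCount_succ (n m : ℕ) (S : ℕ → ℕ → StairSymb) :
    secondDiagCount n (m + 1) S =
      secondDiagCount n m S + if S (n - (m + 1)) (m + 1) ≠ empty then 1 else 0 := by
  rw [secondDiagCount, ← Finset.insert_Icc_right_eq_Icc_add_one (by omega), Finset.filter_insert]
  split_ifs with h
  · rw [Finset.card_insert_of_notMem (by simp), secondDiagCount]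
  · rfl

theorem secondDiagCount_insertCorner {m : ℕ} (hm : m < n) (S : ℕ → ℕ → StairSymb) :
    secondDiagCount (n + 1) m (insertCorner (n - m) (m + 1) S) = secondDiagCount n (m - 1) S := by
  unfold secondDiagCount
  congr 1
  ext i
  simp only [Finset.mem_filter, Finset.mem_Icc]
  constructor
  · rintro ⟨⟨h1, h2⟩, h⟩
    have him : i ≠ m := by
      rintro rfl
      apply h
      unfold insertCorner
      rw [if_pos (by omega), if_neg (by omega)]
    refine ⟨by omega, ?_⟩
    unfold insertCorner unskipIndex at h
    rwa [if_neg (by omega), if_neg (by omega), if_neg (by omega), if_pos (by omega),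
      show n + 1 - i - 1 = n - i by omega] at h
  · rintro ⟨⟨h1, h2⟩, h⟩
    refine ⟨by omega, ?_⟩
    unfold insertCorner unskipIndex
    rwa [if_neg (by omega), if_neg (by omega), if_neg (by omega), if_pos (by omega),
      show n + 1 - i - 1 = n - i by omega]

end SecondDiagonal

/-- The unnormalized `r`-th binomial moment of `secondDiagCount n m`. -/
noncomputable def binomialMoment (α β : ℝ) (n r m : ℕ) : ℝ :=
  ∑ᶠ S ∈ {S | IsStaircase n S}, ((secondDiagCount n m S).choose r : ℝ) * stairWt α β S

theorem binomialMoment_succ (α β : ℝ) {n m : ℕ} (r : ℕ) (hm : m < n) :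
    binomialMoment α β (n + 1) (r + 1) (m + 1) =
      binomialMoment α β (n + 1) (r + 1) m + α * β * binomialMoment α β n r (m - 1) := by
  have hfin := setOf_isStaircase_finite (n + 1)
  have hmarked : α * β * binomialMoment α β n r (m - 1) =
      ∑ᶠ S ∈ {S | IsStaircase (n + 1) S ∧ S (n - m) (m + 1) ≠ empty},
        ((secondDiagCount (n + 1) m S).choose r : ℝ) * stairWt α β S := by
    rw [setOf_isStaircase_nonempty (by omega) (by omega) (by omega), finsum_mem_image
      fun S _ T _ h => by
        rw [← deleteCorner_insertCorner (n - m) (m + 1) S, h, deleteCorner_insertCorner],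
      binomialMoment, mul_finsum_mem]
    refine finsum_mem_congr rfl fun S hS => ?_
    rw [secondDiagCount_insertCorner hm, stairWt_insertCorner α β hS]
    ring
  have hsplit : {S | IsStaircase (n + 1) S} =
      {S | IsStaircase (n + 1) S ∧ S (n - m) (m + 1) = empty} ∪
        {S | IsStaircase (n + 1) S ∧ S (n - m) (m + 1) ≠ empty} := by
    ext S
    simp only [Set.mem_union, Set.mem_ofPred_eq]
    tauto
  have hdisj : Disjoint {S | IsStaircase (n + 1) S ∧ S (n - m) (m + 1) = empty}
      {S | IsStaircase (n + 1) S ∧ S (n - m) (m + 1) ≠ empty} :=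
    Set.disjoint_left.2 fun S h h' => h'.2 h.2
  have hf1 := hfin.subset fun S (h : S ∈ {S | IsStaircase (n + 1) S ∧
    S (n - m) (m + 1) = empty}) => h.1
  have hf2 := hfin.subset fun S (h : S ∈ {S | IsStaircase (n + 1) S ∧
    S (n - m) (m + 1) ≠ empty}) => h.1
  rw [hmarked, binomialMoment, binomialMoment, hsplit, finsum_mem_union hdisj hf1 hf2,
    finsum_mem_union hdisj hf1 hf2, add_assoc, ← finsum_mem_add_distrib hf2]
  refine congrArg₂ (· + ·) (finsum_mem_congr rfl fun S hS => ?_)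
    (finsum_mem_congr rfl fun S hS => ?_)
  · rw [secondDiagCount_succ, Nat.add_sub_add_right, if_neg (by simpa using hS.2), add_zero]
  · rw [secondDiagCount_succ, Nat.add_sub_add_right, if_pos hS.2, Nat.choose_succ_succ]
    push_cast
    ring

theorem binomialMoment_eq (α β : ℝ) (r : ℕ) {n m : ℕ} (hm : m < n) :
    binomialMoment α β n r m = (α * β) ^ r * stairZ (n - r) α β * ((m + 1 - r).choose r : ℝ) := by
  induction r generalizing n m with
  | zero => simp [binomialMoment, stairZ]
  | succ r ih =>
    obtain ⟨n, rfl⟩ := Nat.exists_eq_succ_of_ne_zero (Nat.ne_zero_of_lt hm)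
    rw [Nat.succ_eq_add_one] at hm ⊢
    rw [Nat.add_sub_add_right, Nat.add_sub_add_right]
    induction m with
    | zero => simp [binomialMoment, secondDiagCount_zero]
    | succ m ihm =>
      rw [binomialMoment_succ α β r (by omega), ihm (by omega), ih (by omega)]
      have : (m + 1 - r).choose (r + 1) = (m - r).choose (r + 1) + (m - 1 + 1 - r).choose r := by
        rcases le_or_gt r m with h | h
        · rcases Nat.eq_zero_or_pos m with rfl | hm'
          · obtain rfl : r = 0 := by omega
            simp
          · rw [show m + 1 - r = m - r + 1 by omega, show m - 1 + 1 = m by omega,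
              Nat.choose_succ_succ, add_comm]
        · rw [Nat.choose_eq_zero_of_lt (by omega), Nat.choose_eq_zero_of_lt (by omega),
            Nat.choose_eq_zero_of_lt (by omega)]
      rw [this]
      push_cast
      ring

theorem stairZ_pos {α β : ℝ} (hα : 0 < α) (hβ : 0 < β) (n : ℕ) : 0 < stairZ n α β := by
  rw [stairZ_eq_prod]
  exact Finset.prod_pos fun i _ => by positivity

theorem stairE_descFactorial {α β : ℝ} (hα : 0 < α) (hβ : 0 < β) (r : ℕ) {n : ℕ}
    (hn : 1 ≤ n + r) :
    stairE (n + r) α β (fun S => ((secondDiagCount (n + r) (n + r - 1) S).descFactorial r : ℝ)) =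
      ∏ i ∈ Finset.range r, ((n - i : ℕ) : ℝ) * (α * β) / (α + β + (n + i : ℕ) * (α * β)) := by
  have hZ : stairZ (n + r) α β =
      stairZ n α β * ∏ i ∈ Finset.range r, (α + β + (n + i : ℕ) * (α * β)) := by
    rw [stairZ_eq_prod, Finset.prod_range_add, stairZ_eq_prod]
  have hmom : ∑ᶠ S ∈ {S | IsStaircase (n + r) S},
      ((secondDiagCount (n + r) (n + r - 1) S).descFactorial r : ℝ) * stairWt α β S =
      r.factorial * binomialMoment α β (n + r) r (n + r - 1) := by
    rw [binomialMoment, mul_finsum_mem]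
    refine finsum_mem_congr rfl fun S _ => ?_
    rw [Nat.descFactorial_eq_factorial_mul_choose]
    push_cast
    ring
  have hdesc : (r.factorial : ℝ) * (n.choose r : ℝ) = ∏ i ∈ Finset.range r, ((n - i : ℕ) : ℝ) := by
    rw [← Nat.cast_mul, ← Nat.descFactorial_eq_factorial_mul_choose,
      Nat.descFactorial_eq_prod_range, Nat.cast_prod]
  rw [stairE, hmom, binomialMoment_eq α β r (by omega), hZ, Finset.prod_div_distrib,
    Finset.prod_mul_distrib, ← hdesc, Finset.prod_const, Finset.card_range,
    show n + r - 1 + 1 - r = n by omega, Nat.add_sub_cancel]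
  have := (stairZ_pos hα hβ n).ne'
  rw [← mul_div_mul_left (_ * (α * β) ^ r) _ this]
  congr 1
  ring

theorem tendsto_descFactorial_factor {α β : ℝ} (hα : 0 < α) (hβ : 0 < β) (i : ℕ) :
    Filter.Tendsto
      (fun n : ℕ => ((n - i : ℕ) : ℝ) * (α * β) / (α + β + (n + i : ℕ) * (α * β)))
      Filter.atTop (nhds 1) := by
  rw [← Filter.tendsto_add_atTop_iff_nat i]
  have hαβ : 0 < α * β := mul_pos hα hβ
  have hden : Filter.Tendsto (fun n : ℕ => (n : ℝ) + ((α + β) / (α * β) + 2 * i))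
      Filter.atTop Filter.atTop :=
    Filter.tendsto_atTop_add_const_right _ _ tendsto_natCast_atTop_atTop
  have hlim := (hden.const_div_atTop ((α + β) / (α * β) + 2 * i)).const_sub 1
  rw [sub_zero] at hlim
  refine hlim.congr fun n => ?_
  have : 0 < (n : ℝ) + ((α + β) / (α * β) + 2 * i) := by positivity
  have : 0 < α + β + ((n + i + i : ℕ) : ℝ) * (α * β) := by positivity
  rw [Nat.add_sub_cancel]
  push_cast at this ⊢
  field_simp
  ring

end TableauMoments

/-- The r-th factorial moment of the number `X_n` of nonempty boxes on the second main
diagonal converges to `1`. -/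
theorem factorial_moments_nonempty_second_diagonal
    (α β : ℝ) (hα : 0 < α) (hβ : 0 < β) (r : ℕ) (hr : 1 ≤ r) :
    Filter.Tendsto (fun n : ℕ =>
        stairE n α β (fun S =>
          (Nat.descFactorial
            (((Finset.Icc 1 (n - 1)).filter
              (fun j => S (n - j) j ≠ StairSymb.empty)).card) r : ℝ)))
      Filter.atTop (nhds (1 : ℝ)) := by
  have hprod := tendsto_finsetProd (Finset.range r) fun i _ =>
    tendsto_descFactorial_factor hα hβ i
  rw [Finset.prod_const_one] at hprod
  rw [← Filter.tendsto_add_atTop_iff_nat r]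
  exact hprod.congr fun n => (stairE_descFactorial hα hβ r (by omega)).symm
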